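/- Let df ≥ 1 be an integer, let ν_1, ..., ν_df ∈ [0,1) and λ_1, ..., λ_df ∈ ℝ. Define Q(λ) := (1/2) Σ_{j=1}^{df} (√ν_j X_j + √(1−ν_j) λ_j)² with X_1,...,X_df independent standard normal random variables, c_k(λ) := E[Q(λ)^k]/k!, c_k(0) the same with all λ's zero, and ψ_k(z) := ( Γ(df/2) / ( 2^k Γ(df/2 + k) ) ) z^k for z ≥ 0 and integers k ≥ 0. Then for every z ≥ 0 the series Σ_{k≥0} c_k(λ) ψ_k(z) and Σ_{k≥0} c_k(0) ψ_k(z) converge to strictly positive values, and if for every integer m ≥ 3 the inequality Σ_{j > l ≥ 0, j+l = m} (j−l) · Γ(df/2)² / ( Γ(df/2 + j) Γ(df/2 + l) ) · [ c_j(λ) c_l(0) − c_l(λ) c_j(0) ] ≥ 0 holds, then the function z ↦ ( Σ_{k≥0} c_k(λ) ψ_k(z) ) / ( Σ_{k≥0} c_k(0) ψ_k(z) ) is nondecreasing on [0, ∞). -/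

import Mathlib

open MeasureTheory ProbabilityTheory

noncomputable section

/-- The quadratic form `Q(λ) = (1/2) Σ_j (√ν_j X_j + √(1-ν_j) λ_j)²` evaluated at the
outcome `ω` of the `df` independent standard normal variables. -/
def Qform (df : ℕ) (ν lam : Fin df → ℝ) (ω : Fin df → ℝ) : ℝ :=
  (1 / 2) * ∑ j, (Real.sqrt (ν j) * ω j + Real.sqrt (1 - ν j) * lam j) ^ 2

/-- The product of `df` standard Gaussian measures on `ℝ`. -/
def gaussPi (df : ℕ) : Measure (Fin df → ℝ) :=
  Measure.pi fun _ => gaussianReal 0 1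

/-- `c_k(λ) = E[Q(λ)^k] / k!`. -/
def cCoef (df : ℕ) (ν lam : Fin df → ℝ) (l : ℕ) : ℝ :=
  (∫ ω, Qform df ν lam ω ^ l ∂gaussPi df) / Nat.factorial l

/-- `ψ_k(z) = Γ(df/2) / (2^k Γ(df/2 + k)) · z^k`, the ratio of central chi-square densities
with `df + 2k` and `df` degrees of freedom. -/
def psik (df k : ℕ) (z : ℝ) : ℝ :=
  Real.Gamma ((df : ℝ) / 2) / (2 ^ k * Real.Gamma ((df : ℝ) / 2 + (k : ℝ))) * z ^ k

open Finset Filter Topology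

/-! ### Quotients of entire power series -/

lemma summable_mul_pow_of_nonneg {a : ℕ → ℝ} (ha : ∀ k, 0 ≤ a k)
    (hs : ∀ z : ℝ, 0 ≤ z → Summable fun k => a k * z ^ k) (z : ℝ) :
    Summable fun k => ‖a k * z ^ k‖ := by
  simpa [abs_of_nonneg (ha _)] using hs |z| (abs_nonneg z)

lemma natCast_mul_pow_pred_le {R : ℝ} (hR : 1 ≤ R) (k : ℕ) :
    (k : ℝ) * R ^ (k - 1) ≤ (2 * R) ^ k := by
  have hk : (k : ℝ) ≤ 2 ^ k := by exact_mod_cast (Nat.lt_two_pow_self (n := k)).le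
  rw [mul_pow]
  exact mul_le_mul hk (pow_le_pow_right₀ hR (Nat.sub_le k 1)) (by positivity) (by positivity)

lemma natCast_mul_abs_pow_pred_le {R z : ℝ} (hR : 1 ≤ R) (hz : |z| ≤ R) (k : ℕ) :
    (k : ℝ) * |z| ^ (k - 1) ≤ (2 * R) ^ k :=
  le_trans (by gcongr) (natCast_mul_pow_pred_le hR k)

lemma hasDerivAt_tsum_mul_pow {a : ℕ → ℝ} (ha : ∀ k, 0 ≤ a k)
    (hs : ∀ z : ℝ, 0 ≤ z → Summable fun k => a k * z ^ k) (z : ℝ) :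
    HasDerivAt (fun y => ∑' k, a k * y ^ k) (∑' k, a k * (k * z ^ (k - 1))) z := by
  have hR : (1 : ℝ) ≤ |z| + 1 := by linarith [abs_nonneg z]
  refine hasDerivAt_tsum_of_isPreconnected (t := Metric.ball 0 (|z| + 1)) (y₀ := 0)
    (g := fun k y => a k * y ^ k) (g' := fun k y => a k * (k * y ^ (k - 1)))
    (hs (2 * (|z| + 1)) (by positivity)) Metric.isOpen_ball
    (convex_ball _ _).isPreconnected (fun k y _ => (hasDerivAt_pow k y).const_mul _) ?_
    (by simp; positivity) (hs 0 le_rfl) (by simp)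
  intro k y hy
  have hy' : |y| ≤ |z| + 1 := by simpa using (mem_ball_zero_iff.mp hy).le
  simp only [norm_mul, norm_pow, Real.norm_eq_abs, abs_of_nonneg (ha k), Nat.abs_cast]
  exact mul_le_mul_of_nonneg_left (natCast_mul_abs_pow_pred_le hR hy' k) (ha k)

lemma summable_norm_natCast_mul_mul_pow {a : ℕ → ℝ} (ha : ∀ k, 0 ≤ a k)
    (hs : ∀ z : ℝ, 0 ≤ z → Summable fun k => a k * z ^ k) (z : ℝ) :
    Summable fun k : ℕ => ‖(k : ℝ) * a k * z ^ k‖ := by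
  refine Summable.of_nonneg_of_le (fun _ => norm_nonneg _) (fun k => ?_)
    (hs (2 * |z|) (by positivity))
  have hk : (k : ℝ) ≤ 2 ^ k := by exact_mod_cast (Nat.lt_two_pow_self (n := k)).le
  simp only [norm_mul, norm_pow, Real.norm_eq_abs, abs_of_nonneg (ha k), Nat.abs_cast, mul_pow]
  calc (k : ℝ) * a k * |z| ^ k ≤ 2 ^ k * a k * |z| ^ k := by
        have := ha k
        gcongr
    _ = a k * (2 ^ k * |z| ^ k) := by ring

lemma mul_tsum_mul_pow_pred (a : ℕ → ℝ) (z : ℝ) :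
    z * ∑' k : ℕ, a k * (k * z ^ (k - 1)) = ∑' k : ℕ, (k : ℝ) * a k * z ^ k := by
  rw [← tsum_mul_left]
  congr 1
  ext k
  rcases k with _ | k
  · simp
  · simp only [Nat.add_sub_cancel, pow_succ]
    ring

/-- Antisymmetrising a convolution sum weighted by the difference of the indices. -/
lemma sum_antidiagonal_sub_mul (a b : ℕ → ℝ) (m : ℕ) :
    ∑ p ∈ antidiagonal m, ((p.1 : ℝ) - p.2) * (a p.1 * b p.2) =
      ∑ l ∈ (range (m + 1)).filter (fun l => 2 * l < m),
        ((m : ℝ) - 2 * l) * (a (m - l) * b l - a l * b (m - l)) := by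
  rw [← Nat.sum_antidiagonal_swap,
    Nat.sum_antidiagonal_eq_sum_range_succ_mk,
    ← sum_filter_add_sum_filter_not _ (fun l => 2 * l < m)]
  have hupper : ∑ l ∈ (range (m + 1)).filter (fun l => ¬ 2 * l < m),
        (((m - l : ℕ) : ℝ) - l) * (a (m - l) * b l) =
      ∑ l ∈ (range (m + 1)).filter (fun l => 2 * l < m),
        ((l : ℝ) - ((m - l : ℕ) : ℝ)) * (a l * b (m - l)) := by
    rw [← sum_filter_add_sum_filter_not ((range (m + 1)).filter (fun l => ¬ 2 * l < m))
      (fun l => 2 * l = m)]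
    rw [sum_eq_zero, zero_add]
    · refine sum_nbij' (fun l => m - l) (fun l => m - l) ?_ ?_ ?_ ?_ ?_
      · intro l; simp only [mem_filter, mem_range]; omega
      · intro l; simp only [mem_filter, mem_range]; omega
      · intro l; simp only [mem_filter, mem_range]; omega
      · intro l; simp only [mem_filter, mem_range]; omega
      · intro l hl
        simp only [mem_filter, mem_range] at hl
        rw [Nat.sub_sub_self (by omega)]
    · intro l hl
      simp only [mem_filter, mem_range] at hl
      have : m - l = l := by omega
      simp [this]
  simp only [Prod.swap] at *
  rw [hupper, ← sum_add_distrib]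
  refine sum_congr rfl fun l hl => ?_
  simp only [mem_filter, mem_range] at hl
  rw [Nat.cast_sub (by omega)]
  ring

/-- A quotient of entire power series with nonnegative coefficients is monotone on `[0, ∞)` when
the coefficients of the Wronskian are nonnegative. -/
theorem monotoneOn_tsum_div_tsum {a b : ℕ → ℝ} (ha : ∀ k, 0 ≤ a k) (hb : ∀ k, 0 ≤ b k)
    (hsa : ∀ z : ℝ, 0 ≤ z → Summable fun k => a k * z ^ k)
    (hsb : ∀ z : ℝ, 0 ≤ z → Summable fun k => b k * z ^ k)
    (hpos : ∀ z : ℝ, 0 ≤ z → 0 < ∑' k, b k * z ^ k)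
    (hw : ∀ m : ℕ, 0 ≤ ∑ l ∈ (range (m + 1)).filter (fun l => 2 * l < m),
      ((m : ℝ) - 2 * l) * (a (m - l) * b l - a l * b (m - l))) :
    MonotoneOn (fun z => (∑' k, a k * z ^ k) / ∑' k, b k * z ^ k) (Set.Ici (0 : ℝ)) := by
  have hderiv (z : ℝ) (hz : 0 ≤ z) := (hasDerivAt_tsum_mul_pow ha hsa z).fun_div
    (hasDerivAt_tsum_mul_pow hb hsb z) (hpos z hz).ne'
  refine monotoneOn_of_deriv_nonneg (convex_Ici 0)
    (fun z hz => (hderiv z hz).continuousAt.continuousWithinAt)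
    (fun z hz => (hderiv z (interior_subset hz)).differentiableAt.differentiableWithinAt) ?_
  intro z hz
  have hz0 : 0 < z := by simpa using hz
  rw [(hderiv z hz0.le).deriv]
  refine div_nonneg (nonneg_of_mul_nonneg_right ?_ hz0) (sq_nonneg _)
  have na := summable_mul_pow_of_nonneg ha hsa z
  have nb := summable_mul_pow_of_nonneg hb hsb z
  have nda := summable_norm_natCast_mul_mul_pow ha hsa z
  have ndb := summable_norm_natCast_mul_mul_pow hb hsb z
  rw [mul_sub, ← mul_assoc, mul_left_comm, mul_tsum_mul_pow_pred, mul_tsum_mul_pow_pred,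
    tsum_mul_tsum_eq_tsum_sum_antidiagonal_of_summable_norm nda nb,
    tsum_mul_tsum_eq_tsum_sum_antidiagonal_of_summable_norm na ndb,
    ← (summable_norm_sum_mul_antidiagonal_of_summable_norm nda nb).of_norm.tsum_sub
      (summable_norm_sum_mul_antidiagonal_of_summable_norm na ndb).of_norm]
  refine tsum_nonneg fun m => ?_
  have hm : ∑ p ∈ antidiagonal m, ((p.1 : ℝ) * a p.1 * z ^ p.1) * (b p.2 * z ^ p.2) -
      ∑ p ∈ antidiagonal m, (a p.1 * z ^ p.1) * ((p.2 : ℝ) * b p.2 * z ^ p.2) =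
      z ^ m * ∑ p ∈ antidiagonal m, ((p.1 : ℝ) - p.2) * (a p.1 * b p.2) := by
    rw [← sum_sub_distrib, mul_sum]
    refine sum_congr rfl fun p hp => ?_
    rw [← mem_antidiagonal.mp hp, pow_add]
    ring
  rw [hm, sum_antidiagonal_sub_mul]
  exact mul_nonneg (by positivity) (hw m)

/-! ### Moments of the quadratic form -/

instance isProbabilityMeasure_gaussPi (df : ℕ) : IsProbabilityMeasure (gaussPi df) := by
  unfold gaussPi
  infer_instance

lemma measurePreserving_neg_gaussPi (df : ℕ) :
    MeasurePreserving (fun ω : Fin df → ℝ => -ω) (gaussPi df) (gaussPi df) :=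
  measurePreserving_pi (fun _ => gaussianReal 0 1) (fun _ => gaussianReal 0 1)
    (f := fun _ x => -x) fun _ => ⟨measurable_neg, by simp [gaussianReal_map_neg]⟩

lemma integral_comp_neg_gaussPi (df : ℕ) (f : (Fin df → ℝ) → ℝ) :
    ∫ ω, f (-ω) ∂gaussPi df = ∫ ω, f ω ∂gaussPi df :=
  (measurePreserving_neg_gaussPi df).integral_comp (MeasurableEquiv.neg _).measurableEmbedding f

lemma Qform_nonneg (df : ℕ) (ν lam ω : Fin df → ℝ) : 0 ≤ Qform df ν lam ω := by
  unfold Qform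
  positivity

lemma continuous_Qform (df : ℕ) (ν lam : Fin df → ℝ) : Continuous (Qform df ν lam) := by
  unfold Qform
  fun_prop

lemma Qform_le {df : ℕ} {ν : Fin df → ℝ} (hν : ∀ j, 0 ≤ ν j ∧ ν j < 1) (lam ω : Fin df → ℝ) :
    Qform df ν lam ω ≤ ∑ j, (ω j ^ 2 + lam j ^ 2) := by
  unfold Qform
  rw [mul_sum]
  refine sum_le_sum fun j _ => ?_
  obtain ⟨h0, h1⟩ := hν j
  have e1 := Real.sq_sqrt h0
  have e2 := Real.sq_sqrt (sub_nonneg.mpr h1.le)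
  have b1 : (√(ν j) * ω j) ^ 2 ≤ ω j ^ 2 := by
    rw [mul_pow, e1]; nlinarith [sq_nonneg (ω j)]
  have b2 : (√(1 - ν j) * lam j) ^ 2 ≤ lam j ^ 2 := by
    rw [mul_pow, e2]; nlinarith [sq_nonneg (lam j)]
  nlinarith [sq_nonneg (√(ν j) * ω j - √(1 - ν j) * lam j)]

lemma exists_integrable_exp_Qform {df : ℕ} {ν : Fin df → ℝ} (hν : ∀ j, 0 ≤ ν j ∧ ν j < 1)
    (lam : Fin df → ℝ) :
    ∃ t : ℝ, 0 < t ∧ Integrable (fun ω => Real.exp (t * Qform df ν lam ω)) (gaussPi df) := by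
  obtain ⟨t, ht, hint⟩ := IsGaussian.exists_integrable_exp_sq (gaussianReal 0 1)
  refine ⟨t, ht, ?_⟩
  have hprod : Integrable
      (fun ω : Fin df → ℝ => ∏ j, Real.exp (t * ‖ω j‖ ^ 2) * Real.exp (t * lam j ^ 2))
      (gaussPi df) :=
    Integrable.fintype_prod (f := fun j x => Real.exp (t * ‖x‖ ^ 2) * Real.exp (t * lam j ^ 2))
      fun j => hint.mul_const _
  refine hprod.mono' ?_ (Eventually.of_forall fun ω => ?_)
  · have := continuous_Qform df ν lam
    exact (by fun_prop : Continuous fun ω => Real.exp (t * Qform df ν lam ω)).aestronglyMeasurable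
  · simp only [← Real.exp_add, ← Real.exp_sum, ← mul_add, ← mul_sum, Real.norm_eq_abs,
      Real.abs_exp, sq_abs]
    gcongr
    exact Qform_le hν lam ω

lemma Qform_pow_div_factorial_le {df : ℕ} (ν lam ω : Fin df → ℝ) {t : ℝ} (ht : 0 < t) (k : ℕ) :
    Qform df ν lam ω ^ k / k.factorial ≤ t⁻¹ ^ k * Real.exp (t * Qform df ν lam ω) := by
  have h := Real.pow_div_factorial_le_exp _ (mul_nonneg ht.le (Qform_nonneg df ν lam ω)) k
  rw [mul_pow, mul_div_assoc] at h
  rwa [inv_pow, ← div_eq_inv_mul, le_div_iff₀' (by positivity)]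

lemma integrable_Qform_pow {df : ℕ} {ν : Fin df → ℝ} (hν : ∀ j, 0 ≤ ν j ∧ ν j < 1)
    (lam : Fin df → ℝ) (k : ℕ) :
    Integrable (fun ω => Qform df ν lam ω ^ k) (gaussPi df) := by
  obtain ⟨t, ht, hint⟩ := exists_integrable_exp_Qform hν lam
  refine ((hint.const_mul (t⁻¹ ^ k)).mul_const (k.factorial : ℝ)).mono'
    ((continuous_Qform df ν lam).pow k).aestronglyMeasurable (Eventually.of_forall fun ω => ?_)
  rw [Real.norm_of_nonneg (pow_nonneg (Qform_nonneg df ν lam ω) k),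
    ← div_le_iff₀ (by positivity)]
  exact Qform_pow_div_factorial_le ν lam ω ht k

lemma cCoef_nonneg (df : ℕ) (ν lam : Fin df → ℝ) (k : ℕ) : 0 ≤ cCoef df ν lam k :=
  div_nonneg (integral_nonneg fun ω => pow_nonneg (Qform_nonneg df ν lam ω) k) (by positivity)

lemma cCoef_zero (df : ℕ) (ν lam : Fin df → ℝ) : cCoef df ν lam 0 = 1 := by
  simp [cCoef]

/-- The coefficients `c_k` grow at most geometrically. -/
lemma exists_cCoef_le {df : ℕ} {ν : Fin df → ℝ} (hν : ∀ j, 0 ≤ ν j ∧ ν j < 1)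
    (lam : Fin df → ℝ) : ∃ R C : ℝ, 0 < R ∧ ∀ k, cCoef df ν lam k ≤ C * R ^ k := by
  obtain ⟨t, ht, hint⟩ := exists_integrable_exp_Qform hν lam
  refine ⟨t⁻¹, ∫ ω, Real.exp (t * Qform df ν lam ω) ∂gaussPi df, by positivity, fun k => ?_⟩
  rw [cCoef, ← integral_div, mul_comm, ← integral_const_mul]
  exact integral_mono ((integrable_Qform_pow hν lam k).div_const _) (hint.const_mul _)
    fun ω => Qform_pow_div_factorial_le ν lam ω ht k

lemma Qform_add_Qform_neg {df : ℕ} {ν : Fin df → ℝ} (lam ω : Fin df → ℝ) :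
    2 * Qform df ν (fun _ => 0) ω ≤ Qform df ν lam ω + Qform df ν lam (-ω) := by
  simp only [Qform, Pi.neg_apply, mul_sum, ← sum_add_distrib]
  refine sum_le_sum fun j _ => ?_
  nlinarith [sq_nonneg (√(1 - ν j) * lam j)]

/-- Shifting the Gaussian vector can only increase the moments of the quadratic form. -/
lemma cCoef_zero_shift_le {df : ℕ} {ν : Fin df → ℝ} (hν : ∀ j, 0 ≤ ν j ∧ ν j < 1)
    (lam : Fin df → ℝ) (k : ℕ) : cCoef df ν (fun _ => 0) k ≤ cCoef df ν lam k := by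
  unfold cCoef
  gcongr ?_ / _
  have hi := integrable_Qform_pow hν lam k
  have hi' : Integrable (fun ω => Qform df ν lam (-ω) ^ k) (gaussPi df) :=
    (measurePreserving_neg_gaussPi df).integrable_comp_of_integrable hi
  have hsymm := integral_comp_neg_gaussPi df (fun ω => Qform df ν lam ω ^ k)
  have hle : ∫ ω, 2 * Qform df ν (fun _ => 0) ω ^ k ∂gaussPi df ≤
      ∫ ω, (Qform df ν lam ω ^ k + Qform df ν lam (-ω) ^ k) ∂gaussPi df := by
    refine integral_mono ((integrable_Qform_pow hν _ k).const_mul 2) (hi.add hi') fun ω => ?_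
    have hx := Qform_nonneg df ν lam ω
    have hy := Qform_nonneg df ν lam (-ω)
    have hconv := (convexOn_pow (𝕜 := ℝ) k).2 hx hy (by norm_num : (0 : ℝ) ≤ 1 / 2)
      (by norm_num : (0 : ℝ) ≤ 1 / 2) (by norm_num)
    have hmono := pow_le_pow_left₀ (Qform_nonneg df ν (fun _ => 0) ω)
      (b := 1 / 2 * Qform df ν lam ω + 1 / 2 * Qform df ν lam (-ω))
      (by linarith [Qform_add_Qform_neg (ν := ν) lam ω]) k
    simp only [smul_eq_mul] at hconv
    dsimp only
    linarith
  rw [integral_const_mul, integral_add hi hi', hsymm] at hle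
  linarith

/-! ### The series -/

lemma summable_pow_div_Gamma_add_natCast {s : ℝ} (hs : 0 < s) (x : ℝ) :
    Summable fun k : ℕ => x ^ k / Real.Gamma (s + k) := by
  rcases eq_or_ne x 0 with rfl | hx
  · refine summable_of_ne_finset_zero (s := {0}) fun k hk => ?_
    rw [zero_pow (by simpa using hk), zero_div]
  have hG (k : ℕ) : 0 < Real.Gamma (s + k) := Real.Gamma_pos_of_pos (by positivity)
  refine summable_of_ratio_test_tendsto_lt_one (l := 0) one_pos
    (Eventually.of_forall fun k => div_ne_zero (pow_ne_zero k hx) (hG k).ne') ?_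
  have hlim : Tendsto (fun k : ℕ => |x| / (s + k)) atTop (𝓝 0) :=
    (tendsto_atTop_add_const_left _ s tendsto_natCast_atTop_atTop).const_div_atTop |x|
  refine hlim.congr fun k => ?_
  have hsk : 0 < s + k := by positivity
  have hrec : Real.Gamma (s + (k + 1 : ℕ)) = (s + k) * Real.Gamma (s + k) := by
    rw [← Real.Gamma_add_one hsk.ne']
    push_cast
    ring_nf
  have hx' : |x| ≠ 0 := abs_ne_zero.mpr hx
  have := (hG k).ne'
  simp only [norm_div, norm_pow, Real.norm_eq_abs, hrec, abs_mul, abs_of_pos hsk,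
    abs_of_pos (hG k), abs_pow, pow_succ]
  field_simp

/-- The coefficient of `z ^ k` in `psik df k z`. -/
def psiCoef (df k : ℕ) : ℝ :=
  Real.Gamma ((df : ℝ) / 2) / (2 ^ k * Real.Gamma ((df : ℝ) / 2 + (k : ℝ)))

lemma psiCoef_pos {df : ℕ} (hdf : 1 ≤ df) (k : ℕ) : 0 < psiCoef df k := by
  have h : (0 : ℝ) < (df : ℝ) / 2 := by positivity
  exact div_pos (Real.Gamma_pos_of_pos h)
    (mul_pos (by positivity) (Real.Gamma_pos_of_pos (by positivity)))

lemma cCoef_mul_psik (df : ℕ) (ν lam : Fin df → ℝ) (k : ℕ) (z : ℝ) :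
    cCoef df ν lam k * psik df k z = cCoef df ν lam k * psiCoef df k * z ^ k := by
  rw [psik, psiCoef, mul_assoc]

lemma summable_cCoef_mul_psiCoef_mul_pow {df : ℕ} (hdf : 1 ≤ df) {ν : Fin df → ℝ}
    (hν : ∀ j, 0 ≤ ν j ∧ ν j < 1) (lam : Fin df → ℝ) (z : ℝ) (hz : 0 ≤ z) :
    Summable fun k => cCoef df ν lam k * psiCoef df k * z ^ k := by
  obtain ⟨R, C, hR, hC⟩ := exists_cCoef_le hν lam
  have hs : (0 : ℝ) < (df : ℝ) / 2 := by positivity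
  refine Summable.of_nonneg_of_le (fun k => ?_) (fun k => ?_)
    ((summable_pow_div_Gamma_add_natCast hs (R * z / 2)).mul_left (C * Real.Gamma ((df : ℝ) / 2)))
  · have := cCoef_nonneg df ν lam k
    have := psiCoef_pos hdf k
    positivity
  · have hψ := psiCoef_pos hdf k
    calc cCoef df ν lam k * psiCoef df k * z ^ k ≤ C * R ^ k * psiCoef df k * z ^ k := by
          gcongr
          exact hC k
      _ = _ := by
          rw [psiCoef, div_pow, mul_pow]
          field_simp

lemma tsum_cCoef_mul_psiCoef_mul_pow_pos {df : ℕ} (hdf : 1 ≤ df) {ν : Fin df → ℝ}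
    (hν : ∀ j, 0 ≤ ν j ∧ ν j < 1) (lam : Fin df → ℝ) (z : ℝ) (hz : 0 ≤ z) :
    0 < ∑' k, cCoef df ν lam k * psiCoef df k * z ^ k := by
  refine (summable_cCoef_mul_psiCoef_mul_pow hdf hν lam z hz).tsum_pos (fun k => ?_) 0 ?_
  · have := cCoef_nonneg df ν lam k
    have := psiCoef_pos hdf k
    positivity
  · simpa [cCoef_zero] using psiCoef_pos hdf 0

theorem statement16 (df : ℕ) (hdf : 1 ≤ df) (ν lam : Fin df → ℝ)
    (hν : ∀ j, 0 ≤ ν j ∧ ν j < 1) :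
    (∀ z : ℝ, 0 ≤ z →
        (Summable fun k => cCoef df ν lam k * psik df k z) ∧
          (Summable fun k => cCoef df ν (fun _ => 0) k * psik df k z) ∧
          0 < ∑' k, cCoef df ν lam k * psik df k z ∧
          0 < ∑' k, cCoef df ν (fun _ => 0) k * psik df k z) ∧
      ((∀ m : ℕ, 3 ≤ m →
          0 ≤ ∑ l ∈ (Finset.range (m + 1)).filter (fun l => 2 * l < m),
              ((m : ℝ) - 2 * (l : ℝ)) * Real.Gamma ((df : ℝ) / 2) ^ 2 /
                  (Real.Gamma ((df : ℝ) / 2 + ((m - l : ℕ) : ℝ)) *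
                    Real.Gamma ((df : ℝ) / 2 + (l : ℝ))) *
                (cCoef df ν lam (m - l) * cCoef df ν (fun _ => 0) l -
                  cCoef df ν lam l * cCoef df ν (fun _ => 0) (m - l))) →
        MonotoneOn
          (fun z =>
            (∑' k, cCoef df ν lam k * psik df k z) /
              (∑' k, cCoef df ν (fun _ => 0) k * psik df k z))
          (Set.Ici (0 : ℝ))) := by
  simp only [cCoef_mul_psik]
  have hsum := fun lam => summable_cCoef_mul_psiCoef_mul_pow hdf hν lam
  have hpos := fun lam => tsum_cCoef_mul_psiCoef_mul_pow_pos hdf hν lam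
  refine ⟨fun z hz => ⟨hsum _ z hz, hsum _ z hz, hpos _ z hz, hpos _ z hz⟩, fun hm => ?_⟩
  have hnonneg (lam : Fin df → ℝ) (k : ℕ) : 0 ≤ cCoef df ν lam k * psiCoef df k :=
    mul_nonneg (cCoef_nonneg df ν lam k) (psiCoef_pos hdf k).le
  refine monotoneOn_tsum_div_tsum (hnonneg _) (hnonneg _) (hsum _) (hsum _) (hpos _) fun m => ?_
  rcases lt_or_ge m 3 with hlt | hge
  · refine sum_nonneg fun l hl => ?_
    simp only [mem_filter, mem_range] at hl
    obtain rfl : l = 0 := by omega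
    have hle := cCoef_zero_shift_le hν lam m
    have h0 := (psiCoef_pos hdf 0).le
    have hψ := (psiCoef_pos hdf m).le
    have hfac : cCoef df ν lam m * psiCoef df m * (1 * psiCoef df 0) -
        1 * psiCoef df 0 * (cCoef df ν (fun _ => 0) m * psiCoef df m) =
        psiCoef df 0 * psiCoef df m * (cCoef df ν lam m - cCoef df ν (fun _ => 0) m) := by ring
    simp only [Nat.sub_zero, cCoef_zero, Nat.cast_zero, mul_zero, sub_zero, hfac]
    exact mul_nonneg (Nat.cast_nonneg m)
      (mul_nonneg (mul_nonneg h0 hψ) (sub_nonneg.mpr hle))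
  · refine (mul_nonneg (by positivity : (0 : ℝ) ≤ (2 ^ m)⁻¹) (hm m hge)).trans_eq ?_
    rw [mul_sum]
    refine sum_congr rfl fun l hl => ?_
    simp only [mem_filter, mem_range] at hl
    have hpow : (2 : ℝ) ^ m = 2 ^ (m - l) * 2 ^ l := by
      rw [← pow_add, Nat.sub_add_cancel (by omega)]
    rw [hpow, psiCoef, psiCoef]
    field_simp
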